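/- arXiv:1204.1805 — 2 statements merged into one kernel-verified Lean document; each statement's English description precedes it below -/
import Mathlib

section
/- Let (A, H, ▷, ◁) be a matched pair of groups and r : H → A a deformation map, with r-deformation H_r. Define ▷^r : H_r × A → A by h ▷^r a := r(h)(h ▷ a) r(h ◁ a)^{-1}. Then ▷^r is a left action of the group H_r on the set A, the quadruple (A, H_r, ▷^r, ◁) is a matched pair of groups, and the map ψ : A ⋈^r H_r → A ⋈ H given by ψ(a, h) = (a r(h), h) is an isomorphism of groups, where A ⋈^r H_r is the bicrossed product of (A, H_r, ▷^r, ◁). -/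
/-- A matched pair of groups `(A, H, ▷, ◁)`. -/
structure MatchedPair (A H : Type*) [Group A] [Group H] where
  tr : H → A → A
  tl : H → A → H
  tr_one_act : ∀ a, tr 1 a = a
  tr_mul_act : ∀ h g a, tr (h * g) a = tr h (tr g a)
  tl_one_act : ∀ h, tl h 1 = h
  tl_mul_act : ∀ h a b, tl h (a * b) = tl (tl h a) b
  compat_tr : ∀ h a b, tr h (a * b) = tr h a * tr (tl h a) b
  compat_tl : ∀ h g a, tl (h * g) a = tl h (tr g a) * tl g a

/-- The multiplication of the bicrossed product `A ⋈ H`. -/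
def MatchedPair.bmul {A H : Type*} [Group A] [Group H] (mp : MatchedPair A H)
    (p q : A × H) : A × H :=
  (p.1 * mp.tr p.2 q.1, mp.tl p.2 q.1 * q.2)

/-- A deformation map of the matched pair. -/
def MatchedPair.IsDeformationMap {A H : Type*} [Group A] [Group H]
    (mp : MatchedPair A H) (r : H → A) : Prop :=
  r 1 = 1 ∧ ∀ h g, r (mp.tl h (r g) * g) = r h * mp.tr h (r g)

/-- The deformed multiplication `h • g = (h ◁ r(g)) g` of the group `H_r`. -/
def MatchedPair.dmul {A H : Type*} [Group A] [Group H]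
    (mp : MatchedPair A H) (r : H → A) (h g : H) : H :=
  mp.tl h (r g) * g

/-- The deformed left action `h ▷ʳ a = r(h) (h ▷ a) r(h ◁ a)⁻¹`. -/
def MatchedPair.dtr {A H : Type*} [Group A] [Group H]
    (mp : MatchedPair A H) (r : H → A) (h : H) (a : A) : A :=
  r h * mp.tr h a * (r (mp.tl h a))⁻¹

/-- The shear `(a, x) ↦ (a r(x), x)` is bijective. -/
theorem bijective_mul_right_shear {A X : Type*} [Group A] (r : X → A) :
    Function.Bijective (fun p : A × X => ((p.1 * r p.2, p.2) : A × X)) :=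
  Function.bijective_iff_has_inverse.mpr
    ⟨fun p => (p.1 * (r p.2)⁻¹, p.2), fun p => by simp, fun p => by simp⟩

namespace MatchedPair

variable {A H : Type*} [Group A] [Group H] (mp : MatchedPair A H)

theorem one_tl (a : A) : mp.tl 1 a = 1 := by
  have h := mp.compat_tl 1 1 a
  rw [mp.tr_one_act, mul_one] at h
  exact left_eq_mul.mp h

theorem dtr_mul_r (r : H → A) (h : H) (a : A) :
    mp.dtr r h a * r (mp.tl h a) = r h * mp.tr h a :=
  inv_mul_cancel_right _ _

theorem dtr_mul (r : H → A) (h : H) (a b : A) :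
    mp.dtr r h (a * b) = mp.dtr r h a * mp.dtr r (mp.tl h a) b := by
  simp only [dtr, mp.compat_tr, mp.tl_mul_act]
  group

theorem dmul_tl (r : H → A) (h g : H) (a : A) :
    mp.tl (mp.dmul r h g) a = mp.dmul r (mp.tl h (mp.dtr r g a)) (mp.tl g a) := by
  simp only [dmul, mp.compat_tl, ← mp.tl_mul_act, dtr_mul_r]

variable {mp} {r : H → A}

theorem IsDeformationMap.map_dmul (hr : mp.IsDeformationMap r) (h g : H) :
    r (mp.dmul r h g) = r h * mp.tr h (r g) :=
  hr.2 h g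

theorem IsDeformationMap.one_dtr (hr : mp.IsDeformationMap r) (a : A) :
    mp.dtr r 1 a = a := by
  simp [dtr, mp.one_tl, mp.tr_one_act, hr.1]

theorem IsDeformationMap.dmul_dtr (hr : mp.IsDeformationMap r) (h g : H) (a : A) :
    mp.dtr r (mp.dmul r h g) a = mp.dtr r h (mp.dtr r g a) := by
  apply mul_right_cancel (b := r (mp.tl (mp.dmul r h g) a))
  rw [dtr_mul_r, dmul_tl, hr.map_dmul, hr.map_dmul, ← mul_assoc, dtr_mul_r, mul_assoc,
    mul_assoc, ← mp.compat_tr, dtr_mul_r, mp.compat_tr, dmul, mp.tr_mul_act]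

theorem IsDeformationMap.mul_r_bmul (hr : mp.IsDeformationMap r) (p q : A × H) :
    (p.1 * mp.dtr r p.2 q.1 * r (mp.dmul r (mp.tl p.2 q.1) q.2),
      mp.dmul r (mp.tl p.2 q.1) q.2) =
      mp.bmul (p.1 * r p.2, p.2) (q.1 * r q.2, q.2) := by
  rw [hr.map_dmul, mul_assoc p.1, ← mul_assoc (mp.dtr r p.2 q.1), dtr_mul_r]
  simp only [bmul, dmul, mp.compat_tr, mp.tl_mul_act, mul_assoc]

end MatchedPair

/-- Given a matched pair `(A, H, ▷, ◁)` and a deformation map `r : H → A`, the map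
`▷ʳ : H_r × A → A`, `h ▷ʳ a = r(h)(h ▷ a)r(h ◁ a)⁻¹`, is a left action of the group `H_r`
(the `r`-deformation of `H`, with multiplication `•`) on the set `A`,
`(A, H_r, ▷ʳ, ◁)` is a matched pair of groups, and `ψ : A ⋈ʳ H_r → A ⋈ H`,
`ψ(a, h) = (a r(h), h)`, is an isomorphism of groups. -/
theorem stmt7 {A H : Type*} [Group A] [Group H] (mp : MatchedPair A H)
    (r : H → A) (hr : mp.IsDeformationMap r) :
    -- ▷ʳ is a left action of the group `H_r` on the set `A`
    (∀ a : A, mp.dtr r 1 a = a) ∧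
    (∀ h g a, mp.dtr r (mp.dmul r h g) a = mp.dtr r h (mp.dtr r g a)) ∧
    -- ◁ is a right action of the group `A` on the set `H_r`
    (∀ h : H, mp.tl h 1 = h) ∧
    (∀ h a b, mp.tl h (a * b) = mp.tl (mp.tl h a) b) ∧
    -- the matched pair compatibilities for `(A, H_r, ▷ʳ, ◁)`
    (∀ h a b, mp.dtr r h (a * b) = mp.dtr r h a * mp.dtr r (mp.tl h a) b) ∧
    (∀ h g a, mp.tl (mp.dmul r h g) a =
      mp.dmul r (mp.tl h (mp.dtr r g a)) (mp.tl g a)) ∧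
    -- ψ : A ⋈ʳ H_r → A ⋈ H is an isomorphism of groups
    Function.Bijective (fun p : A × H => ((p.1 * r p.2, p.2) : A × H)) ∧
    (∀ p q : A × H,
      (fun p : A × H => ((p.1 * r p.2, p.2) : A × H))
          ((p.1 * mp.dtr r p.2 q.1, mp.dmul r (mp.tl p.2 q.1) q.2) : A × H) =
        mp.bmul ((p.1 * r p.2, p.2) : A × H) ((q.1 * r q.2, q.2) : A × H)) :=
  ⟨hr.one_dtr, hr.dmul_dtr, mp.tl_one_act, mp.tl_mul_act, mp.dtr_mul r, mp.dmul_tl r,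
    bijective_mul_right_shear r, hr.mul_r_bmul⟩
end

section
/- Let A and H be groups and A ⋉ H an arbitrary semidirect product of A and H. Then the factorization index of A in A ⋉ H is 1, i.e. every A-complement of A ⋉ H is isomorphic to H. In particular, the following Krull–Schmidt type theorem holds: if ψ : A ⋈ H' → A ⋉ H is an isomorphism of groups that stabilizes A, where A ⋈ H' is an arbitrary bicrossed product of a matched pair (A, H', ▷', ◁'), then the groups H' and H are isomorphic. -/
/-- If `f : K →* A ⋊[φ] H` has no nontrivial element mapped into `A`, and every element of
`A ⋊[φ] H` is a product of an element of `A` and one of the range of `f`, then `K ≃* H`. -/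
theorem SemidirectProduct.nonempty_mulEquiv_of_factorization {A H K : Type*} [Group A] [Group H]
    [Group K] {φ : H →* MulAut A} (f : K →* A ⋊[φ] H)
    (hf : ∀ k a, f k = SemidirectProduct.inl a → k = 1)
    (hs : ∀ g : A ⋊[φ] H, ∃ a k, g = SemidirectProduct.inl a * f k) :
    Nonempty (K ≃* H) := by
  refine ⟨MulEquiv.ofBijective (SemidirectProduct.rightHom.comp f) ⟨?_, fun h => ?_⟩⟩
  · refine (injective_iff_map_eq_one _).2 fun k hk => hf k (f k).left ?_
    exact SemidirectProduct.ext rfl hk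
  · obtain ⟨a, k, hk⟩ := hs (SemidirectProduct.inr h)
    exact ⟨k, by simpa using (congrArg SemidirectProduct.rightHom hk).symm⟩

namespace MatchedPair

variable {A H : Type*} [Group A] [Group H] (mp : MatchedPair A H)

theorem tr_one (h : H) : mp.tr h 1 = 1 := by
  simpa [mp.tl_one_act] using mp.compat_tr h 1 1

theorem bmul_one_left (h g : H) : mp.bmul (1, h) (1, g) = (1, h * g) := by
  simp [bmul, mp.tr_one, mp.tl_one_act]

theorem bmul_inl_inr (a : A) (h : H) : mp.bmul (a, 1) (1, h) = (a, h) := by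
  simp [bmul, mp.tr_one, mp.tl_one_act]

end MatchedPair

/-- For an arbitrary semidirect product `A ⋊ H` (the bicrossed product with trivial right
action), the factorization index of `A` in `A ⋊ H` is `1`: `H` is an `A`-complement of
`A ⋊ H` and every `A`-complement of `A ⋊ H` is isomorphic to `H`.  In particular the
following Krull–Schmidt type theorem holds: if `ψ : A ⋈ H' → A ⋊ H` is an isomorphism of
groups stabilizing `A`, for an arbitrary bicrossed product `A ⋈ H'`, then `H' ≅ H`. -/
theorem stmt11 {A H : Type*} [Group A] [Group H] (φ : H →* MulAut A) :
    -- `H` is an `A`-complement of `A ⋊[φ] H`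
    (∀ g : A ⋊[φ] H, ∃ (a : A) (h : H),
      g = SemidirectProduct.inl a * SemidirectProduct.inr h) ∧
    (SemidirectProduct.inl : A →* A ⋊[φ] H).range ⊓
      (SemidirectProduct.inr : H →* A ⋊[φ] H).range = ⊥ ∧
    -- every `A`-complement of `A ⋊[φ] H` is isomorphic to `H`
    (∀ K : Subgroup (A ⋊[φ] H),
      (∀ g : A ⋊[φ] H, ∃ (a : A), ∃ h ∈ K, g = SemidirectProduct.inl a * h) →
      (SemidirectProduct.inl : A →* A ⋊[φ] H).range ⊓ K = ⊥ →
      Nonempty (K ≃* H)) ∧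
    -- Krull–Schmidt type theorem for bicrossed products
    (∀ (H' : Type*) [Group H'], ∀ (mp' : MatchedPair A H') (ψ : A × H' → A ⋊[φ] H),
      Function.Bijective ψ →
      (∀ p q : A × H', ψ (mp'.bmul p q) = ψ p * ψ q) →
      (∀ a : A, ψ (a, 1) = SemidirectProduct.inl a) →
      Nonempty (H' ≃* H)) := by
  refine ⟨fun g => ⟨g.left, g.right, (SemidirectProduct.inl_left_mul_inr_right g).symm⟩,
    ?_, fun K hK hd => ?_, fun H' _ mp ψ hψ hmul hinl => ?_⟩
  · rw [eq_bot_iff]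
    rintro _ ⟨⟨a, rfl⟩, h, hh⟩
    obtain rfl : h = 1 := by simpa using congrArg SemidirectProduct.rightHom hh
    simpa using hh.symm
  · refine SemidirectProduct.nonempty_mulEquiv_of_factorization K.subtype (fun k a hk => ?_)
      fun g => ?_
    · have : (k : A ⋊[φ] H) ∈ (⊥ : Subgroup (A ⋊[φ] H)) := hd ▸ ⟨⟨a, hk.symm⟩, k.2⟩
      exact Subtype.ext (Subgroup.mem_bot.1 this)
    · obtain ⟨a, h, hh, rfl⟩ := hK g
      exact ⟨a, ⟨h, hh⟩, rfl⟩
  · let f : H' →* A ⋊[φ] H := MonoidHom.mk' (fun h => ψ (1, h)) fun h g => by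
      rw [← hmul, mp.bmul_one_left]
    refine SemidirectProduct.nonempty_mulEquiv_of_factorization f (fun k a hk => ?_) fun g => ?_
    · exact congrArg Prod.snd (hψ.1 (hk.trans (hinl a).symm))
    · obtain ⟨⟨a, h⟩, rfl⟩ := hψ.2 g
      exact ⟨a, h, by rw [← hinl]; exact mp.bmul_inl_inr a h ▸ hmul (a, 1) (1, h)⟩
end
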